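/- arXiv:1810.08556 — 8 statements merged into one kernel-verified Lean document; each statement's English description precedes it below -/
import Mathlib

section
/- Let n ≥ 1 and let A, M be real symmetric n×n matrices with M positive definite, and suppose there is λ₁ > 0 such that zᵀAz ≥ λ₁ zᵀMz for all z ∈ ℝⁿ. Let m ∈ ℝⁿ with m_j > 0 for all j, let γ > 0, α > 0, and ψ, f, d ∈ ℝⁿ. Suppose (u, y, p) ∈ ℝⁿ × ℝⁿ × ℝⁿ satisfies, for every j: (Ay)_j + γ³ m_j ((y_j − ψ_j)⁻)³ = (Mu)_j + f_j (state equation), (Ap)_j + 3γ³ m_j ((y_j − ψ_j)⁻)² p_j = (My)_j − d_j (adjoint equation), and α u_j + p_j = 0. Suppose further there exists η ≤ 0 such that p_j ≥ η (y_j − ψ_j) whenever y_j > ψ_j, 3 p_j ≥ η (ψ_j − y_j) whenever y_j < ψ_j, p_j ≥ 0 whenever y_j = ψ_j, and |η| ≤ α λ₁ + √(α² λ₁² + α). Then for every v ∈ ℝⁿ and every ỹ ∈ ℝⁿ satisfying (Aỹ)_j + γ³ m_j ((ỹ_j − ψ_j)⁻)³ = (Mv)_j + f_j for all j, one has ½ ỹᵀMỹ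 − dᵀỹ + (α/2) vᵀMv ≥ ½ yᵀMy − dᵀy + (α/2) uᵀMu. If in addition |η| < α λ₁ + √(α² λ₁² + α) and v ≠ u, then the inequality is strict. -/
open Matrix

theorem Matrix.IsSymm.dotProduct_mulVec_comm {ι R : Type*} [Fintype ι] [CommSemiring R]
    {B : Matrix ι ι R} (hB : B.IsSymm) (x z : ι → R) :
    x ⬝ᵥ B.mulVec z = z ⬝ᵥ B.mulVec x := by
  rw [dotProduct_mulVec, ← mulVec_transpose, hB.eq, dotProduct_comm]

/-- The multiplier times the second-order Taylor remainder of the cubed negative part is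
controlled by the monotonicity gap of the cubed negative part. -/
theorem mul_monotonicity_gap_le_taylor_remainder {s t p η : ℝ} (hη : η ≤ 0)
    (hplus : 0 < s → η * s ≤ p) (hminus : s < 0 → η * (-s) ≤ 3 * p) (hzero : s = 0 → 0 ≤ p) :
    η * ((t - s) * (min t 0 ^ 3 - min s 0 ^ 3)) ≤
      -p * (min t 0 ^ 3 - min s 0 ^ 3) + 3 * min s 0 ^ 2 * p * (t - s) := by
  have key : ∀ D Q q : ℝ, 0 ≤ Q → η * q ≤ p → q * Q ≤ D → η * D ≤ p * Q := by
    intro D Q q hQ hq hD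
    calc η * D ≤ η * (q * Q) := mul_le_mul_of_nonpos_left hD hη
      _ = η * q * Q := by ring
      _ ≤ p * Q := mul_le_mul_of_nonneg_right hq hQ
  rcases lt_or_ge s 0 with hs | hs
  · have hq : η * (-s / 3) ≤ p := by linarith [hminus hs]
    rw [min_eq_left hs.le]
    obtain ⟨a, rfl⟩ : ∃ a, s = -a := ⟨-s, by ring⟩
    have ha : 0 < a := by linarith
    rcases le_total t 0 with ht | ht
    · rw [min_eq_left ht]
      obtain ⟨b, rfl⟩ : ∃ b, t = -b := ⟨-t, by ring⟩
      have hb : 0 ≤ b := by linarith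
      have h := key ((a - b) ^ 2 * (a ^ 2 + a * b + b ^ 2)) ((a - b) ^ 2 * (b + 2 * a)) _
        (by positivity) hq (by
          have : 0 ≤ (a - b) ^ 2 * (a ^ 2 / 3 + 2 / 3 * (a * b) + b ^ 2) := by positivity
          nlinarith)
      linarith
    · rw [min_eq_right ht]
      have h := key (a ^ 3 * (a + t)) (2 * a ^ 3 + 3 * a ^ 2 * t) _ (by positivity) hq (by
        have : 0 < a ^ 4 := by positivity
        nlinarith)
      linarith
  · have hq : η * s ≤ p := by
      rcases hs.eq_or_lt with h | h
      · simpa [← h] using hzero h.symm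
      · exact hplus h
    rw [min_eq_right hs]
    rcases le_total t 0 with ht | ht
    · rw [min_eq_left ht]
      obtain ⟨b, rfl⟩ : ∃ b, t = -b := ⟨-t, by ring⟩
      have hb : 0 ≤ b := by linarith
      have h := key ((b + s) * b ^ 3) (b ^ 3) _ (by positivity) hq (by
        have : 0 ≤ b * b ^ 3 := by positivity
        nlinarith)
      linarith
    · simp [min_eq_right ht]

/-- The quadratic form minorizing the cost increment, multiplied by its leading coefficient. -/
theorem mul_sq_sub_le_quadratic_form {n : ℕ} {M : Matrix (Fin n) (Fin n) ℝ}
    (hsymm : M.IsSymm) (hnonneg : ∀ z : Fin n → ℝ, 0 ≤ z ⬝ᵥ M.mulVec z)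
    (K α h : ℝ) (x z : Fin n → ℝ) :
    (K * (α / 2) - (h / 2) ^ 2) * (z ⬝ᵥ M.mulVec z) ≤
      K * (K * (x ⬝ᵥ M.mulVec x) + α / 2 * (z ⬝ᵥ M.mulVec z) - h * (x ⬝ᵥ M.mulVec z)) := by
  have := hnonneg (K • x - (h / 2) • z)
  simp only [mulVec_sub, mulVec_smul, dotProduct_sub, sub_dotProduct, dotProduct_smul,
    smul_dotProduct, smul_eq_mul, hsymm.dotProduct_mulVec_comm z x] at this
  linarith

theorem cost_increment_lower_bound {n : ℕ} {A M : Matrix (Fin n) (Fin n) ℝ}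
    (hA : A.IsSymm) (hMsymm : M.IsSymm) {lam : ℝ}
    (hcoerc : ∀ z : Fin n → ℝ, lam * (z ⬝ᵥ M.mulVec z) ≤ z ⬝ᵥ A.mulVec z)
    {m : Fin n → ℝ} (hm : ∀ j, 0 < m j) {γ : ℝ} (hγ : 0 < γ) {α : ℝ}
    {ψ f d u y p v ytil : Fin n → ℝ}
    (hstate : ∀ j, A.mulVec y j + γ ^ 3 * m j * (min (y j - ψ j) 0) ^ 3 = M.mulVec u j + f j)
    (hadj : ∀ j, A.mulVec p j + 3 * γ ^ 3 * m j * (min (y j - ψ j) 0) ^ 2 * p j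
      = M.mulVec y j - d j)
    (hgrad : ∀ j, α * u j + p j = 0)
    {η : ℝ} (hη : η ≤ 0)
    (hplus : ∀ j, ψ j < y j → η * (y j - ψ j) ≤ p j)
    (hminus : ∀ j, y j < ψ j → η * (ψ j - y j) ≤ 3 * p j)
    (hzero : ∀ j, y j = ψ j → 0 ≤ p j)
    (hstate' : ∀ j, A.mulVec ytil j + γ ^ 3 * m j * (min (ytil j - ψ j) 0) ^ 3
      = M.mulVec v j + f j) :
    (1 / 2) * (y ⬝ᵥ M.mulVec y) - d ⬝ᵥ y + (α / 2) * (u ⬝ᵥ M.mulVec u) +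
      ((1 / 2 + |η| * lam) * ((ytil - y) ⬝ᵥ M.mulVec (ytil - y)) +
        α / 2 * ((v - u) ⬝ᵥ M.mulVec (v - u)) - |η| * ((ytil - y) ⬝ᵥ M.mulVec (v - u))) ≤
      (1 / 2) * (ytil ⬝ᵥ M.mulVec ytil) - d ⬝ᵥ ytil + (α / 2) * (v ⬝ᵥ M.mulVec v) := by
  obtain ⟨x, rfl⟩ : ∃ x, ytil = y + x := ⟨ytil - y, by abel⟩
  obtain ⟨w, rfl⟩ : ∃ w, v = u + w := ⟨v - u, by abel⟩
  obtain rfl : p = -(α • u) := by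
    ext j
    simpa using eq_neg_of_add_eq_zero_right (hgrad j)
  set p := -(α • u) with hp
  have hdiff : ∀ j, γ ^ 3 * m j * (min (y j + x j - ψ j) 0 ^ 3 - min (y j - ψ j) 0 ^ 3)
      = M.mulVec w j - A.mulVec x j := by
    intro j
    have h1 := hstate j
    have h2 := hstate' j
    simp only [mulVec_add, Pi.add_apply] at h2
    linarith
  have hpoint : ∀ j, η * (x j * (M.mulVec w j - A.mulVec x j)) ≤
      -(p j * (M.mulVec w j - A.mulVec x j)) + x j * (M.mulVec y j - d j - A.mulVec p j) := by
    intro j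
    have h := mul_monotonicity_gap_le_taylor_remainder (t := y j + x j - ψ j) hη
      (fun h => hplus j (sub_pos.1 h))
      (fun h => by simpa using hminus j (sub_neg.1 h)) (fun h => hzero j (sub_eq_zero.1 h))
    have h' := mul_le_mul_of_nonneg_left h (mul_pos (pow_pos hγ 3) (hm j)).le
    rw [← hdiff j, ← hadj j]
    linarith
  have hsum : η * (x ⬝ᵥ (M.mulVec w - A.mulVec x)) ≤
      -(p ⬝ᵥ (M.mulVec w - A.mulVec x)) + x ⬝ᵥ (M.mulVec y - d - A.mulVec p) := by
    simp only [dotProduct, Finset.mul_sum, ← Finset.sum_neg_distrib, ← Finset.sum_add_distrib]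
    exact Finset.sum_le_sum fun j _ => hpoint j
  have hcoerc' := mul_le_mul_of_nonpos_left (hcoerc x) hη
  have hpw : p ⬝ᵥ M.mulVec w = -(α * (u ⬝ᵥ M.mulVec w)) := by
    simp [hp, neg_dotProduct, smul_dotProduct]
  simp only [dotProduct_sub, hpw, hA.dotProduct_mulVec_comm x p] at hsum
  simp only [add_sub_cancel_left, mulVec_add, dotProduct_add, add_dotProduct, abs_of_nonpos hη,
    hMsymm.dotProduct_mulVec_comm y x, hMsymm.dotProduct_mulVec_comm w u,
    dotProduct_comm d x]
  linarith

theorem two_mul_sub_sq_eq {α lam : ℝ} (hα : 0 < α) (h : ℝ) :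
    α + 2 * α * lam * h - h ^ 2 =
      (α * lam + √(α ^ 2 * lam ^ 2 + α) - h) * (h - α * lam + √(α ^ 2 * lam ^ 2 + α)) := by
  have := Real.sq_sqrt (by positivity : 0 ≤ α ^ 2 * lam ^ 2 + α)
  linarith

theorem stmt_0 (n : ℕ) (hn : 1 ≤ n)
    (A M : Matrix (Fin n) (Fin n) ℝ) (hA : A.IsSymm) (hMsymm : M.IsSymm) (hM : M.PosDef)
    (lam : ℝ) (hlam : 0 < lam)
    (hcoerc : ∀ z : Fin n → ℝ, lam * (z ⬝ᵥ M.mulVec z) ≤ z ⬝ᵥ A.mulVec z)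
    (m : Fin n → ℝ) (hm : ∀ j, 0 < m j)
    (γ : ℝ) (hγ : 0 < γ) (α : ℝ) (hα : 0 < α)
    (ψ f d : Fin n → ℝ) (u y p : Fin n → ℝ)
    (hstate : ∀ j, A.mulVec y j + γ ^ 3 * m j * (min (y j - ψ j) 0) ^ 3 = M.mulVec u j + f j)
    (hadj : ∀ j, A.mulVec p j + 3 * γ ^ 3 * m j * (min (y j - ψ j) 0) ^ 2 * p j
      = M.mulVec y j - d j)
    (hgrad : ∀ j, α * u j + p j = 0)
    (η : ℝ) (hη : η ≤ 0)
    (hplus : ∀ j, ψ j < y j → η * (y j - ψ j) ≤ p j)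
    (hminus : ∀ j, y j < ψ j → η * (ψ j - y j) ≤ 3 * p j)
    (hzero : ∀ j, y j = ψ j → 0 ≤ p j)
    (hbound : |η| ≤ α * lam + Real.sqrt (α ^ 2 * lam ^ 2 + α)) :
    (∀ v ytil : Fin n → ℝ,
      (∀ j, A.mulVec ytil j + γ ^ 3 * m j * (min (ytil j - ψ j) 0) ^ 3 = M.mulVec v j + f j) →
      (1 / 2) * (y ⬝ᵥ M.mulVec y) - d ⬝ᵥ y + (α / 2) * (u ⬝ᵥ M.mulVec u) ≤
      (1 / 2) * (ytil ⬝ᵥ M.mulVec ytil) - d ⬝ᵥ ytil + (α / 2) * (v ⬝ᵥ M.mulVec v)) ∧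
    (|η| < α * lam + Real.sqrt (α ^ 2 * lam ^ 2 + α) →
      ∀ v ytil : Fin n → ℝ,
      (∀ j, A.mulVec ytil j + γ ^ 3 * m j * (min (ytil j - ψ j) 0) ^ 3 = M.mulVec v j + f j) →
      v ≠ u →
      (1 / 2) * (y ⬝ᵥ M.mulVec y) - d ⬝ᵥ y + (α / 2) * (u ⬝ᵥ M.mulVec u) <
      (1 / 2) * (ytil ⬝ᵥ M.mulVec ytil) - d ⬝ᵥ ytil + (α / 2) * (v ⬝ᵥ M.mulVec v)) := by
  have hnonneg : ∀ z : Fin n → ℝ, 0 ≤ z ⬝ᵥ M.mulVec z := fun z => by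
    simpa using hM.posSemidef.dotProduct_mulVec_nonneg z
  have hK : 0 < 1 / 2 + |η| * lam := by positivity
  have hfactor : 0 < |η| - α * lam + √(α ^ 2 * lam ^ 2 + α) := by
    have : α * lam < √(α ^ 2 * lam ^ 2 + α) := Real.lt_sqrt_of_sq_lt (by linarith [mul_pow α lam 2])
    linarith [abs_nonneg η]
  have hdet := two_mul_sub_sq_eq (lam := lam) hα |η|
  refine ⟨fun v ytil hv => ?_, fun hlt v ytil hv hne => ?_⟩
  all_goals
    have hinc := cost_increment_lower_bound hA hMsymm hcoerc hm hγ hstate hadj hgrad hη hplus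
      hminus hzero hv
    have hquad := mul_sq_sub_le_quadratic_form hMsymm hnonneg (1 / 2 + |η| * lam) α |η|
      (ytil - y) (v - u)
  · have hcoef : 0 ≤ (1 / 2 + |η| * lam) * (α / 2) - (|η| / 2) ^ 2 := by
      linarith [mul_nonneg (sub_nonneg.2 hbound) hfactor.le]
    have := nonneg_of_mul_nonneg_right ((mul_nonneg hcoef (hnonneg _)).trans hquad) hK
    linarith
  · have hcoef : 0 < (1 / 2 + |η| * lam) * (α / 2) - (|η| / 2) ^ 2 := by
      linarith [mul_pos (sub_pos.2 hlt) hfactor]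
    have hpos : 0 < (v - u) ⬝ᵥ M.mulVec (v - u) := by
      simpa using hM.dotProduct_mulVec_pos (sub_ne_zero.2 hne)
    have := pos_of_mul_pos_right ((mul_pos hcoef hpos).trans_le hquad) hK.le
    linarith
end

section
/- Let n ≥ 1 and let A, M be real symmetric n×n matrices with M positive definite, and suppose there is λ₁ > 0 such that zᵀAz ≥ λ₁ zᵀMz for all z ∈ ℝⁿ. Let α > 0 and ψ, f, d ∈ ℝⁿ. Suppose (u, y, p, ξ, μ) ∈ (ℝⁿ)⁵ satisfies, for every j: (Ay)_j = (Mu)_j + f_j + ξ_j; y_j ≥ ψ_j, ξ_j ≥ 0, ξ_j (y_j − ψ_j) = 0; (Ap)_j = (My)_j − d_j − μ_j; (y_j − ψ_j) μ_j = 0, ξ_j p_j = 0; α u_j + p_j = 0; and suppose there exists η ≤ 0 with p_j ≥ η (y_j − ψ_j) for all j, μ_j ≥ η ξ_j for all j, and |η| ≤ α λ₁ + √(α² λ₁² + α). Then for every v ∈ ℝⁿ and every pair (ỹ, ξ̃) ∈ ℝⁿ × ℝⁿ satisfying (Aỹ)_j = (Mv)_j + f_j + ξ̃_j, ỹ_j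 ≥ ψ_j, ξ̃_j ≥ 0 and ξ̃_j (ỹ_j − ψ_j) = 0 for all j, one has ½ ỹᵀMỹ − dᵀỹ + (α/2) vᵀMv ≥ ½ yᵀMy − dᵀy + (α/2) uᵀMu. If in addition |η| < α λ₁ + √(α² λ₁² + α) and v ≠ u, then the inequality is strict. -/
open Matrix

theorem dotProduct_mulVec_comm_of_isSymm {ι : Type*} [Fintype ι] {B : Matrix ι ι ℝ}
    (hB : B.IsSymm) (x z : ι → ℝ) : x ⬝ᵥ B.mulVec z = z ⬝ᵥ B.mulVec x := by
  rw [dotProduct_mulVec, ← mulVec_transpose, hB.eq, dotProduct_comm]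

/-- The cost difference of two controls, expressed through the adjoint equation. -/
theorem reduced_cost_sub_eq {ι : Type*} [Fintype ι] {A M : Matrix ι ι ℝ}
    (hA : A.IsSymm) (hM : M.IsSymm) {α : ℝ} {f d u y p ξ μ v z ζ : ι → ℝ}
    (hy : A.mulVec y = M.mulVec u + f + ξ) (hz : A.mulVec z = M.mulVec v + f + ζ)
    (hadj : A.mulVec p = M.mulVec y - d - μ) (hp : p = -(α • u)) :
    ((1 / 2) * (z ⬝ᵥ M.mulVec z) - d ⬝ᵥ z + (α / 2) * (v ⬝ᵥ M.mulVec v)) -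
      ((1 / 2) * (y ⬝ᵥ M.mulVec y) - d ⬝ᵥ y + (α / 2) * (u ⬝ᵥ M.mulVec u)) =
    (1 / 2) * ((z - y) ⬝ᵥ M.mulVec (z - y)) + (α / 2) * ((v - u) ⬝ᵥ M.mulVec (v - u)) +
      (μ ⬝ᵥ (z - y) + p ⬝ᵥ (ζ - ξ)) := by
  have hpM (w : ι → ℝ) : p ⬝ᵥ M.mulVec w = -(α * (u ⬝ᵥ M.mulVec w)) := by
    rw [hp, neg_dotProduct, smul_dotProduct, smul_eq_mul]
  have hpy := dotProduct_mulVec_comm_of_isSymm hA p y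
  have hpz := dotProduct_mulVec_comm_of_isSymm hA p z
  rw [hy, hadj] at hpy
  rw [hz, hadj] at hpz
  simp only [dotProduct_add, dotProduct_sub, hpM] at hpy hpz
  have hyz := dotProduct_mulVec_comm_of_isSymm hM y z
  have huv := dotProduct_mulVec_comm_of_isSymm hM u v
  simp only [mulVec_sub, dotProduct_sub, sub_dotProduct]
  rw [dotProduct_comm y d, dotProduct_comm y μ] at hpy
  rw [dotProduct_comm z d, dotProduct_comm z μ] at hpz
  rw [huv] at hpz ⊢
  rw [hyz]
  linarith

/-- Sign conditions and complementarity bound the multiplier terms from below. -/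
theorem multiplier_terms_ge {ι : Type*} [Fintype ι] {ψ y p ξ μ z ζ : ι → ℝ} {η : ℝ}
    (hy : ∀ j, ψ j ≤ y j ∧ 0 ≤ ξ j ∧ ξ j * (y j - ψ j) = 0)
    (hz : ∀ j, ψ j ≤ z j ∧ 0 ≤ ζ j ∧ ζ j * (z j - ψ j) = 0)
    (hcomp : ∀ j, (y j - ψ j) * μ j = 0 ∧ ξ j * p j = 0)
    (hp : ∀ j, η * (y j - ψ j) ≤ p j) (hμ : ∀ j, η * ξ j ≤ μ j) :
    -η * ((z - y) ⬝ᵥ (ζ - ξ)) ≤ μ ⬝ᵥ (z - y) + p ⬝ᵥ (ζ - ξ) := by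
  simp only [dotProduct, Pi.sub_apply, Finset.mul_sum, ← Finset.sum_add_distrib]
  refine Finset.sum_le_sum fun j _ => ?_
  obtain ⟨-, -, hyc⟩ := hy j
  obtain ⟨hzψ, hζ, hzc⟩ := hz j
  obtain ⟨hc₁, hc₂⟩ := hcomp j
  have h₁ := mul_le_mul_of_nonneg_right (hμ j) (sub_nonneg.2 hzψ)
  have h₂ := mul_le_mul_of_nonneg_right (hp j) hζ
  linear_combination h₁ + h₂ + hc₁ + hc₂ - η * hyc - η * hzc

theorem quadratic_gap_eq {ι : Type*} [Fintype ι] {M : Matrix ι ι ℝ} (hM : M.IsSymm)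
    (α lam k : ℝ) (e w : ι → ℝ) :
    2 * α * ((1 / 2) * (e ⬝ᵥ M.mulVec e) + (α / 2) * (w ⬝ᵥ M.mulVec w) +
      k * (lam * (e ⬝ᵥ M.mulVec e) - e ⬝ᵥ M.mulVec w)) =
    (k • e - α • w) ⬝ᵥ M.mulVec (k • e - α • w) +
      (α + 2 * α * lam * k - k ^ 2) * (e ⬝ᵥ M.mulVec e) := by
  simp only [mulVec_sub, mulVec_smul, dotProduct_sub, sub_dotProduct, dotProduct_smul,
    smul_dotProduct, smul_eq_mul]
  rw [dotProduct_mulVec_comm_of_isSymm hM w e]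
  ring

theorem quadratic_gap_nonneg {ι : Type*} [Fintype ι] {M : Matrix ι ι ℝ} (hM : M.PosDef)
    (hMsymm : M.IsSymm) {α lam k : ℝ} (hα : 0 < α) (hk : 0 ≤ α + 2 * α * lam * k - k ^ 2)
    (e w : ι → ℝ) :
    0 ≤ (1 / 2) * (e ⬝ᵥ M.mulVec e) + (α / 2) * (w ⬝ᵥ M.mulVec w) +
      k * (lam * (e ⬝ᵥ M.mulVec e) - e ⬝ᵥ M.mulVec w) := by
  have hnn (x : ι → ℝ) : 0 ≤ x ⬝ᵥ M.mulVec x := by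
    simpa using hM.posSemidef.dotProduct_mulVec_nonneg x
  refine nonneg_of_mul_nonneg_right ?_ (by positivity : 0 < 2 * α)
  rw [quadratic_gap_eq hMsymm]
  exact add_nonneg (hnn _) (mul_nonneg hk (hnn e))

theorem quadratic_gap_pos {ι : Type*} [Fintype ι] {M : Matrix ι ι ℝ} (hM : M.PosDef)
    (hMsymm : M.IsSymm) {α lam k : ℝ} (hα : 0 < α) (hk : 0 < α + 2 * α * lam * k - k ^ 2)
    (e : ι → ℝ) {w : ι → ℝ} (hw : w ≠ 0) :
    0 < (1 / 2) * (e ⬝ᵥ M.mulVec e) + (α / 2) * (w ⬝ᵥ M.mulVec w) +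
      k * (lam * (e ⬝ᵥ M.mulVec e) - e ⬝ᵥ M.mulVec w) := by
  have hpos {x : ι → ℝ} (hx : x ≠ 0) : 0 < x ⬝ᵥ M.mulVec x := by
    simpa using hM.dotProduct_mulVec_pos hx
  have hnn (x : ι → ℝ) : 0 ≤ x ⬝ᵥ M.mulVec x := by
    simpa using hM.posSemidef.dotProduct_mulVec_nonneg x
  rcases eq_or_ne e 0 with rfl | he
  · simpa using mul_pos (half_pos hα) (hpos hw)
  · refine pos_of_mul_pos_right ?_ (by positivity : 0 ≤ 2 * α)
    rw [quadratic_gap_eq hMsymm]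
    exact add_pos_of_nonneg_of_pos (hnn _) (mul_pos hk (hpos he))

theorem stmt_1 (n : ℕ) (hn : 1 ≤ n)
    (A M : Matrix (Fin n) (Fin n) ℝ) (hA : A.IsSymm) (hMsymm : M.IsSymm) (hM : M.PosDef)
    (lam : ℝ) (hlam : 0 < lam)
    (hcoerc : ∀ z : Fin n → ℝ, lam * (z ⬝ᵥ M.mulVec z) ≤ z ⬝ᵥ A.mulVec z)
    (α : ℝ) (hα : 0 < α)
    (ψ f d : Fin n → ℝ) (u y p ξ μ : Fin n → ℝ)
    (hstate : ∀ j, A.mulVec y j = M.mulVec u j + f j + ξ j)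
    (hfeas : ∀ j, ψ j ≤ y j ∧ 0 ≤ ξ j ∧ ξ j * (y j - ψ j) = 0)
    (hadj : ∀ j, A.mulVec p j = M.mulVec y j - d j - μ j)
    (hcomp : ∀ j, (y j - ψ j) * μ j = 0 ∧ ξ j * p j = 0)
    (hgrad : ∀ j, α * u j + p j = 0)
    (η : ℝ) (hη : η ≤ 0)
    (hp : ∀ j, η * (y j - ψ j) ≤ p j)
    (hμ : ∀ j, η * ξ j ≤ μ j)
    (hbound : |η| ≤ α * lam + Real.sqrt (α ^ 2 * lam ^ 2 + α)) :
    (∀ v ytil ξtil : Fin n → ℝ,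
      (∀ j, A.mulVec ytil j = M.mulVec v j + f j + ξtil j) →
      (∀ j, ψ j ≤ ytil j ∧ 0 ≤ ξtil j ∧ ξtil j * (ytil j - ψ j) = 0) →
      (1 / 2) * (y ⬝ᵥ M.mulVec y) - d ⬝ᵥ y + (α / 2) * (u ⬝ᵥ M.mulVec u) ≤
      (1 / 2) * (ytil ⬝ᵥ M.mulVec ytil) - d ⬝ᵥ ytil + (α / 2) * (v ⬝ᵥ M.mulVec v)) ∧
    (|η| < α * lam + Real.sqrt (α ^ 2 * lam ^ 2 + α) →
      ∀ v ytil ξtil : Fin n → ℝ,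
      (∀ j, A.mulVec ytil j = M.mulVec v j + f j + ξtil j) →
      (∀ j, ψ j ≤ ytil j ∧ 0 ≤ ξtil j ∧ ξtil j * (ytil j - ψ j) = 0) →
      v ≠ u →
      (1 / 2) * (y ⬝ᵥ M.mulVec y) - d ⬝ᵥ y + (α / 2) * (u ⬝ᵥ M.mulVec u) <
      (1 / 2) * (ytil ⬝ᵥ M.mulVec ytil) - d ⬝ᵥ ytil + (α / 2) * (v ⬝ᵥ M.mulVec v)) := by
  have hk : 0 ≤ -η := neg_nonneg.2 hη
  have hr : 0 ≤ α ^ 2 * lam ^ 2 + α := by positivity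
  have hαlam : 0 < α * lam := mul_pos hα hlam
  have hs_sq := Real.sq_sqrt hr
  have hs_lt : α * lam < Real.sqrt (α ^ 2 * lam ^ 2 + α) :=
    Real.lt_sqrt_of_sq_lt (by nlinarith)
  rw [abs_of_nonpos hη] at hbound ⊢
  set s := Real.sqrt (α ^ 2 * lam ^ 2 + α)
  have hfactor : α + 2 * α * lam * -η - (-η) ^ 2 =
      (α * lam + s - -η) * (-η + (s - α * lam)) := by
    linear_combination -hs_sq
  have hgap : ∀ v ytil ξtil : Fin n → ℝ,
      (∀ j, A.mulVec ytil j = M.mulVec v j + f j + ξtil j) →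
      (∀ j, ψ j ≤ ytil j ∧ 0 ≤ ξtil j ∧ ξtil j * (ytil j - ψ j) = 0) →
      (1 / 2) * ((ytil - y) ⬝ᵥ M.mulVec (ytil - y)) +
        (α / 2) * ((v - u) ⬝ᵥ M.mulVec (v - u)) +
        -η * (lam * ((ytil - y) ⬝ᵥ M.mulVec (ytil - y)) - (ytil - y) ⬝ᵥ M.mulVec (v - u)) ≤
      ((1 / 2) * (ytil ⬝ᵥ M.mulVec ytil) - d ⬝ᵥ ytil + (α / 2) * (v ⬝ᵥ M.mulVec v)) -
        ((1 / 2) * (y ⬝ᵥ M.mulVec y) - d ⬝ᵥ y + (α / 2) * (u ⬝ᵥ M.mulVec u)) := by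
    intro v ytil ξtil hstate' hfeas'
    have hpu : p = -(α • u) := by
      ext j
      simpa using eq_neg_of_add_eq_zero_right (hgrad j)
    rw [reduced_cost_sub_eq hA hMsymm (funext hstate) (funext hstate') (funext hadj) hpu]
    have hmult := multiplier_terms_ge hfeas hfeas' hcomp hp hμ
    have hslack : ξtil - ξ = A.mulVec (ytil - y) - M.mulVec (v - u) := by
      ext j
      simp only [mulVec_sub, Pi.sub_apply, hstate, hstate']
      ring
    rw [hslack, dotProduct_sub, mul_sub] at hmult
    rw [hslack]
    have hc := mul_le_mul_of_nonneg_left (hcoerc (ytil - y)) hk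
    linarith
  refine ⟨fun v ytil ξtil hstate' hfeas' => ?_,
    fun hlt v ytil ξtil hstate' hfeas' hvu => ?_⟩
  · have hpoly : 0 ≤ α + 2 * α * lam * -η - (-η) ^ 2 :=
      hfactor ▸ mul_nonneg (by linarith) (by linarith)
    exact sub_nonneg.1 ((quadratic_gap_nonneg hM hMsymm hα hpoly _ _).trans
      (hgap v ytil ξtil hstate' hfeas'))
  · have hpoly : 0 < α + 2 * α * lam * -η - (-η) ^ 2 :=
      hfactor ▸ mul_pos (by linarith) (by linarith)
    exact sub_pos.1 ((quadratic_gap_pos hM hMsymm hα hpoly _ (sub_ne_zero.2 hvu)).trans_le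
      (hgap v ytil ξtil hstate' hfeas'))
end

section
/- Let n ≥ 1, let A, M be real symmetric n×n matrices with A and M positive definite, let m ∈ ℝⁿ with m_j > 0 for all j, γ > 0, α > 0, and ψ, f, d ∈ ℝⁿ. Let S : ℝⁿ → ℝⁿ be a map such that for every v ∈ ℝⁿ and every j, (A S(v))_j + γ³ m_j ((S(v)_j − ψ_j)⁻)³ = (Mv)_j + f_j. If u ∈ ℝⁿ is a local minimum of the function J(v) := ½ S(v)ᵀ M S(v) − dᵀ S(v) + (α/2) vᵀ M v, then, writing y := S(u), there exists p ∈ ℝⁿ such that for every j: (Ap)_j + 3γ³ m_j ((y_j − ψ_j)⁻)² p_j = (My)_j − d_j and α u_j + p_j = 0. -/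
open Matrix

theorem hasDerivAt_min_zero_cube (s : ℝ) :
    HasDerivAt (fun x : ℝ => (min x 0) ^ 3) (3 * (min s 0) ^ 2) s := by
  have h1 := hasDerivAt_abs_rpow s (p := 3) (by norm_num)
  have h2 := ((hasDerivAt_pow 3 s).sub h1).div_const 2
  have e : (fun x : ℝ => (min x 0) ^ 3) = fun x => (x ^ 3 - |x| ^ (3 : ℝ)) / 2 := by
    funext x
    have : |x| ^ (3 : ℝ) = |x| ^ 3 := by exact_mod_cast Real.rpow_natCast |x| 3
    rw [this]
    rcases le_total x 0 with hx | hx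
    · rw [min_eq_left hx, abs_of_nonpos hx]; ring
    · rw [min_eq_right hx, abs_of_nonneg hx]; ring
  rw [e]
  refine h2.congr_deriv ?_
  have : (3 : ℝ) - 2 = 1 := by norm_num
  rw [this, Real.rpow_one]
  rcases le_total s 0 with hx | hx
  · rw [min_eq_left hx, abs_of_nonpos hx]; push_cast; ring
  · rw [min_eq_right hx, abs_of_nonneg hx]; push_cast; ring

section Calculus

variable {ι : Type*} [Fintype ι]

theorem HasDerivAt.real_dotProduct {a b : ℝ → ι → ℝ} {a' b' : ι → ℝ} {t : ℝ}
    (ha : HasDerivAt a a' t) (hb : HasDerivAt b b' t) :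
    HasDerivAt (fun s => a s ⬝ᵥ b s) (a' ⬝ᵥ b t + a t ⬝ᵥ b') t := by
  simp only [dotProduct, ← Finset.sum_add_distrib]
  exact HasDerivAt.fun_sum fun i _ =>
    (hasDerivAt_pi.1 ha i).mul (hasDerivAt_pi.1 hb i)

theorem HasDerivAt.real_mulVec (Q : Matrix ι ι ℝ) {a : ℝ → ι → ℝ} {a' : ι → ℝ} {t : ℝ}
    (ha : HasDerivAt a a' t) : HasDerivAt (fun s => Q *ᵥ a s) (Q *ᵥ a') t := by
  refine hasDerivAt_pi.2 fun i => ?_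
  simp only [mulVec, dotProduct]
  exact HasDerivAt.fun_sum fun j _ => (hasDerivAt_pi.1 ha j).const_mul _

theorem Matrix.IsSymm.dotProduct_mulVec_comm_s2 {Q : Matrix ι ι ℝ} (hQ : Q.IsSymm) (x y : ι → ℝ) :
    x ⬝ᵥ Q *ᵥ y = y ⬝ᵥ Q *ᵥ x := by
  rw [dotProduct_mulVec, ← mulVec_transpose, hQ.eq, dotProduct_comm]

theorem HasDerivAt.dotProduct_mulVec_self {Q : Matrix ι ι ℝ} (hQ : Q.IsSymm)
    {a : ℝ → ι → ℝ} {a' : ι → ℝ} {t : ℝ} (ha : HasDerivAt a a' t) :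
    HasDerivAt (fun s => a s ⬝ᵥ Q *ᵥ a s) (2 * (a' ⬝ᵥ Q *ᵥ a t)) t := by
  refine (ha.real_dotProduct (ha.real_mulVec Q)).congr_deriv ?_
  rw [hQ.dotProduct_mulVec_comm_s2 (a t) a']
  ring

/-- A positive definite matrix plus a diagonal monotone nonlinearity is injective. -/
theorem Matrix.PosDef.injective_mulVec_add_monotone {A : Matrix ι ι ℝ} (hA : A.PosDef)
    {φ : ι → ℝ → ℝ} (hφ : ∀ i, Monotone (φ i)) {x y : ι → ℝ}
    (h : ∀ i, (A *ᵥ x) i + φ i (x i) = (A *ᵥ y) i + φ i (y i)) : x = y := by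
  by_contra hne
  have hpos := hA.dotProduct_mulVec_pos (sub_ne_zero.2 hne)
  have hle : (x - y) ⬝ᵥ A *ᵥ (x - y) ≤ 0 := by
    refine Finset.sum_nonpos fun i _ => ?_
    have h1 : (A *ᵥ (x - y)) i = φ i (y i) - φ i (x i) := by
      rw [mulVec_sub, Pi.sub_apply]
      linarith [h i]
    rw [h1, Pi.sub_apply]
    rcases le_total (x i) (y i) with hxy | hxy
    · exact mul_nonpos_of_nonpos_of_nonneg (by linarith) (by linarith [hφ i hxy])
    · exact mul_nonpos_of_nonneg_of_nonpos (by linarith) (by linarith [hφ i hxy])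
  rw [star_trivial] at hpos
  exact absurd hpos hle.not_gt

end Calculus

theorem monotone_min_zero_cube (c b : ℝ) (hc : 0 ≤ c) :
    Monotone fun x : ℝ => c * (min (x - b) 0) ^ 3 := by
  intro x y hxy
  have h : min (x - b) 0 ≤ min (y - b) 0 := min_le_min_right 0 (by linarith)
  exact mul_le_mul_of_nonneg_left ((Odd.strictMono_pow (by decide)).monotone h) hc

theorem stmt_2 (n : ℕ) (hn : 1 ≤ n)
    (A M : Matrix (Fin n) (Fin n) ℝ) (hAsymm : A.IsSymm) (hMsymm : M.IsSymm)
    (hA : A.PosDef) (hM : M.PosDef)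
    (m : Fin n → ℝ) (hm : ∀ j, 0 < m j)
    (γ : ℝ) (hγ : 0 < γ) (α : ℝ) (hα : 0 < α)
    (ψ f d : Fin n → ℝ)
    (S : (Fin n → ℝ) → (Fin n → ℝ))
    (hS : ∀ v : Fin n → ℝ, ∀ j,
      A.mulVec (S v) j + γ ^ 3 * m j * (min (S v j - ψ j) 0) ^ 3 = M.mulVec v j + f j)
    (u : Fin n → ℝ)
    (hu : IsLocalMin (fun v : Fin n → ℝ =>
      (1 / 2) * (S v ⬝ᵥ M.mulVec (S v)) - d ⬝ᵥ S v + (α / 2) * (v ⬝ᵥ M.mulVec v)) u) :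
    ∃ p : Fin n → ℝ, ∀ j,
      A.mulVec p j + 3 * γ ^ 3 * m j * (min (S u j - ψ j) 0) ^ 2 * p j
        = M.mulVec (S u) j - d j ∧
      α * u j + p j = 0 := by
  refine ⟨-α • u, fun j => ⟨?_, by simp⟩⟩
  have hdet : IsUnit M.det := hM.det_pos.ne'.isUnit
  have hMinv (w : Fin n → ℝ) : M *ᵥ (M⁻¹ *ᵥ w) = w := by
    rw [mulVec_mulVec, mul_nonsing_inv _ hdet, one_mulVec]
  -- The state moves along a coordinate line; `v` is the control producing it.
  let h : Fin n → ℝ := Pi.single j 1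
  let y : ℝ → Fin n → ℝ := fun t => S u + t • h
  let w : ℝ → Fin n → ℝ := fun t i =>
    (A *ᵥ y t) i + γ ^ 3 * m i * (min (y t i - ψ i) 0) ^ 3 - f i
  let v : ℝ → Fin n → ℝ := fun t => M⁻¹ *ᵥ w t
  let w' : Fin n → ℝ := fun i =>
    (A *ᵥ h) i + γ ^ 3 * m i * (3 * (min (S u i - ψ i) 0) ^ 2 * h i)
  have hy0 : y 0 = S u := by simp [y]
  have hw0 : w 0 = M *ᵥ u := by
    funext i
    simp only [w, hy0]
    linarith [hS u i]
  have hv0 : v 0 = u := by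
    simp only [v, hw0]
    rw [mulVec_mulVec, nonsing_inv_mul _ hdet, one_mulVec]
  have hSv (t : ℝ) : S (v t) = y t := by
    refine hA.injective_mulVec_add_monotone (φ := fun i x => γ ^ 3 * m i * (min (x - ψ i) 0) ^ 3)
      (fun i => monotone_min_zero_cube _ _ (by have := hm i; positivity)) fun i => ?_
    have := hS (v t) i
    simp only [v, hMinv] at this
    simp only [v, this, w]
    ring
  have hy : HasDerivAt y h 0 := by
    exact (((hasDerivAt_id (0 : ℝ)).smul_const h).const_add (S u)).congr_deriv (one_smul ℝ h)
  have hw : HasDerivAt w w' 0 := by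
    refine hasDerivAt_pi.2 fun i => ?_
    have h1 := hasDerivAt_pi.1 (hy.real_mulVec A) i
    have h2 := (hasDerivAt_pi.1 hy i).sub_const (ψ i)
    have h3 := (hasDerivAt_min_zero_cube (y 0 i - ψ i)).comp (0 : ℝ) h2
    rw [hy0] at h3
    exact (h1.add (h3.const_mul (γ ^ 3 * m i))).sub_const (f i)
  have hv : HasDerivAt v (M⁻¹ *ᵥ w') 0 := hw.real_mulVec M⁻¹
  have hJ := (((hy.dotProduct_mulVec_self hMsymm).const_mul (1 / 2)).sub
    ((hasDerivAt_const (0 : ℝ) d).real_dotProduct hy)).add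
    ((hv.dotProduct_mulVec_self hMsymm).const_mul (α / 2))
  have hmin : IsLocalMin (fun t => (1 / 2) * (y t ⬝ᵥ M *ᵥ y t) - d ⬝ᵥ y t
      + (α / 2) * (v t ⬝ᵥ M *ᵥ v t)) 0 := by
    have := hv.continuousAt.tendsto.eventually (hv0.symm ▸ hu)
    simpa only [IsLocalMin, IsMinFilter, hSv] using this
  have hzero := hmin.hasDerivAt_eq_zero hJ
  rw [hMsymm.dotProduct_mulVec_comm_s2 (M⁻¹ *ᵥ w'), hMinv, hv0, hy0] at hzero
  have hw'u : u ⬝ᵥ w' = (A *ᵥ u) j + 3 * γ ^ 3 * m j * (min (S u j - ψ j) 0) ^ 2 * u j := by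
    have : w' = A *ᵥ h +
        (Pi.single j (3 * γ ^ 3 * m j * (min (S u j - ψ j) 0) ^ 2) : Fin n → ℝ) := by
      funext i
      rcases eq_or_ne i j with rfl | hij
      · simp [w', h]; ring
      · simp [w', h, hij]
    rw [this, dotProduct_add, hAsymm.dotProduct_mulVec_comm_s2, single_one_dotProduct,
      dotProduct_single]
    ring
  rw [hw'u] at hzero
  simp only [h, single_one_dotProduct, dotProduct_single_one, zero_dotProduct] at hzero
  rw [mulVec_smul, Pi.smul_apply, Pi.smul_apply, smul_eq_mul, smul_eq_mul]
  linarith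
end

section
/- Let n ≥ 1, let A be a real symmetric positive definite n×n matrix, let m ∈ ℝⁿ with m_j ≥ 0 for all j, let γ ≥ 0, and let ψ, b ∈ ℝⁿ. Then there exists exactly one y ∈ ℝⁿ such that (Ay)_j + γ³ m_j ((y_j − ψ_j)⁻)³ = b_j for every j. -/
open Matrix

theorem Matrix.PosDef.exists_mul_norm_sq_le {ι : Type*} [Fintype ι] {A : Matrix ι ι ℝ}
    (hA : A.PosDef) : ∃ c > 0, ∀ x : ι → ℝ, c * ‖x‖ ^ 2 ≤ x ⬝ᵥ A *ᵥ x := by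
  have hcont : Continuous fun x : ι → ℝ => x ⬝ᵥ A *ᵥ x := by fun_prop
  rcases (Metric.sphere (0 : ι → ℝ) 1).eq_empty_or_nonempty with hS | hS
  · refine ⟨1, one_pos, fun x => ?_⟩
    have hx : x = 0 := by
      by_contra hx
      have : ‖x‖⁻¹ • x ∈ Metric.sphere (0 : ι → ℝ) 1 := by
        simp [norm_smul, hx]
      simp [hS] at this
    simp [hx]
  · obtain ⟨z, hz, hmin⟩ := (isCompact_sphere (0 : ι → ℝ) 1).exists_isMinOn hS hcont.continuousOn
    have hz0 : z ≠ 0 := by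
      rintro rfl
      simp at hz
    refine ⟨z ⬝ᵥ A *ᵥ z, by simpa using hA.dotProduct_mulVec_pos hz0, fun x => ?_⟩
    rcases eq_or_ne x 0 with rfl | hx
    · simp
    have hmem : ‖x‖⁻¹ • x ∈ Metric.sphere (0 : ι → ℝ) 1 := by
      simp [norm_smul, hx]
    have hle : z ⬝ᵥ A *ᵥ z ≤ (‖x‖⁻¹ • x) ⬝ᵥ A *ᵥ (‖x‖⁻¹ • x) := hmin hmem
    have hpos : 0 < ‖x‖ := norm_pos_iff.mpr hx
    rw [mulVec_smul, dotProduct_smul, smul_dotProduct, smul_eq_mul, smul_eq_mul] at hle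
    calc _ ≤ ‖x‖⁻¹ * (‖x‖⁻¹ * (x ⬝ᵥ A *ᵥ x)) * ‖x‖ ^ 2 := by gcongr
      _ = _ := by field_simp

/-- A symmetric positive definite linear system perturbed by a diagonal gradient field whose
potential is nonnegative is solvable. -/
theorem Matrix.PosDef.exists_mulVec_add_eq {ι : Type*} [Fintype ι] {A : Matrix ι ι ℝ}
    (hA : A.PosDef) (hsymm : A.IsSymm) {F f : ι → ℝ → ℝ} (hF : ∀ j t, 0 ≤ F j t)
    (hderiv : ∀ j t, HasDerivAt (F j) (f j t) t) (b : ι → ℝ) :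
    ∃ y : ι → ℝ, ∀ j, (A *ᵥ y) j + f j (y j) = b j := by
  classical
  obtain ⟨c, hc, hbound⟩ := hA.exists_mul_norm_sq_le
  set J : (ι → ℝ) → ℝ := fun y => y ⬝ᵥ A *ᵥ y / 2 - b ⬝ᵥ y + ∑ j, F j (y j) with hJ
  have hFc (j : ι) : Continuous (F j) :=
    continuous_iff_continuousAt.mpr fun t => (hderiv j t).continuousAt
  have hJc : Continuous J := by
    have h (j : ι) : Continuous fun y : ι → ℝ => F j (y j) := (hFc j).comp (continuous_apply j)
    fun_prop
  have hlower (y : ι → ℝ) : ‖y‖ * (c / 2 * ‖y‖ - ∑ j, |b j|) ≤ J y := by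
    have h1 : b ⬝ᵥ y ≤ (∑ j, |b j|) * ‖y‖ := by
      rw [dotProduct, Finset.sum_mul]
      refine Finset.sum_le_sum fun j _ => (le_abs_self _).trans ?_
      rw [abs_mul]
      gcongr
      exact norm_le_pi_norm y j
    have h2 : 0 ≤ ∑ j, F j (y j) := Finset.sum_nonneg fun j _ => hF j _
    have h3 := hbound y
    simp only [hJ]
    linarith
  have hlim : Filter.Tendsto J (Filter.cocompact _) Filter.atTop := by
    refine Filter.tendsto_atTop_mono hlower ?_
    have hn := tendsto_norm_cocompact_atTop (E := ι → ℝ)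
    exact hn.atTop_mul_atTop₀
      (Filter.tendsto_atTop_add_const_right _ _ (hn.const_mul_atTop (by positivity)))
  obtain ⟨y, hy⟩ := hJc.exists_forall_le hlim
  refine ⟨y, fun j => ?_⟩
  have hline (t : ℝ) : J (y + t • Pi.single j 1) =
      y ⬝ᵥ A *ᵥ y / 2 + t * (A *ᵥ y) j + t ^ 2 * A j j / 2 - b ⬝ᵥ y - t * b j
        + (F j (y j + t) + ∑ i ∈ Finset.univ.erase j, F i (y i)) := by
    have hsum : ∑ i, F i ((y + t • Pi.single j 1 : ι → ℝ) i) =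
        F j (y j + t) + ∑ i ∈ Finset.univ.erase j, F i (y i) := by
      rw [← Finset.add_sum_erase _ _ (Finset.mem_univ j)]
      congr 1
      · simp
      · refine Finset.sum_congr rfl fun i hi => ?_
        simp [Pi.single_eq_of_ne (Finset.ne_of_mem_erase hi)]
    have hcross : y ⬝ᵥ A *ᵥ Pi.single j 1 = (A *ᵥ y) j := by
      rw [dotProduct_mulVec, ← mulVec_transpose, hsymm.eq]
      simp
    simp only [hJ]
    rw [hsum]
    simp only [mulVec_add, mulVec_smul, dotProduct_add, add_dotProduct, smul_dotProduct,
      dotProduct_smul, smul_eq_mul, hcross, single_one_dotProduct, dotProduct_single_one]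
    simp
    ring
  have hd : HasDerivAt (fun t : ℝ => J (y + t • Pi.single j 1))
      ((A *ᵥ y) j - b j + f j (y j)) 0 := by
    simp_rw [hline]
    have hFj : HasDerivAt (fun t => F j (y j + t)) (f j (y j)) 0 := by
      have := hderiv j (y j + 0)
      simpa using this.comp_const_add (y j) 0
    have hid := hasDerivAt_id (0 : ℝ)
    refine HasDerivAt.congr_deriv ((((((hid.mul_const ((A *ᵥ y) j)).const_add (y ⬝ᵥ A *ᵥ y / 2)).add
      (((hid.pow 2).mul_const (A j j)).div_const 2)).sub_const (b ⬝ᵥ y)).sub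
      (hid.mul_const (b j))).add (hFj.add_const _)) ?_
    simp
  have hmin : IsLocalMin (fun t : ℝ => J (y + t • Pi.single j 1)) 0 :=
    Filter.Eventually.of_forall fun t => by simpa using hy (y + t • Pi.single j 1)
  linarith [hmin.hasDerivAt_eq_zero hd]

theorem Matrix.PosDef.eq_of_mulVec_add_eq {ι : Type*} [Fintype ι] {A : Matrix ι ι ℝ}
    (hA : A.PosDef) {f : ι → ℝ → ℝ} (hf : ∀ j, Monotone (f j)) {x y : ι → ℝ}
    (h : ∀ j, (A *ᵥ x) j + f j (x j) = (A *ᵥ y) j + f j (y j)) : x = y := by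
  by_contra hne
  have hpos : 0 < (x - y) ⬝ᵥ A *ᵥ (x - y) := by
    simpa using hA.dotProduct_mulVec_pos (sub_ne_zero.mpr hne)
  refine hpos.not_ge (Finset.sum_nonpos fun j _ => ?_)
  have hj : (A *ᵥ (x - y)) j = f j (y j) - f j (x j) := by
    rw [mulVec_sub, Pi.sub_apply]
    linarith [h j]
  rw [hj, Pi.sub_apply]
  rcases le_total (x j) (y j) with hle | hle
  · exact mul_nonpos_of_nonpos_of_nonneg (sub_nonpos.mpr hle) (sub_nonneg.mpr (hf j hle))
  · exact mul_nonpos_of_nonneg_of_nonpos (sub_nonneg.mpr hle) (sub_nonpos.mpr (hf j hle))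

theorem hasDerivAt_min_zero_pow_four (t : ℝ) :
    HasDerivAt (fun s : ℝ => min s 0 ^ 4) (4 * min t 0 ^ 3) t := by
  rcases lt_trichotomy t 0 with ht | rfl | ht
  · rw [min_eq_left ht.le]
    have h : HasDerivAt (fun s : ℝ => s ^ 4) (4 * t ^ 3) t := by simpa using hasDerivAt_pow 4 t
    refine h.congr_of_eventuallyEq ?_
    filter_upwards [Iio_mem_nhds ht] with s hs
    rw [min_eq_left (le_of_lt hs)]
  · have h : (fun s : ℝ => min s 0 ^ 4) =O[nhds 0] fun s => ‖s - 0‖ ^ 4 := by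
      refine Asymptotics.IsBigO.of_norm_le fun s => ?_
      rw [norm_pow, sub_zero]
      gcongr
      rcases le_total s 0 with hs | hs <;> simp [hs]
    simpa using (h.hasFDerivAt (by norm_num)).hasDerivAt
  · rw [min_eq_right ht.le]
    refine ((hasDerivAt_const t (0 : ℝ)).congr_of_eventuallyEq ?_).congr_deriv (by simp)
    filter_upwards [Ioi_mem_nhds ht] with s hs
    simp [le_of_lt (Set.mem_Ioi.mp hs)]

theorem stmt_3 (n : ℕ) (hn : 1 ≤ n)
    (A : Matrix (Fin n) (Fin n) ℝ) (hAsymm : A.IsSymm) (hA : A.PosDef)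
    (m : Fin n → ℝ) (hm : ∀ j, 0 ≤ m j)
    (γ : ℝ) (hγ : 0 ≤ γ)
    (ψ b : Fin n → ℝ) :
    ∃! y : Fin n → ℝ, ∀ j,
      A.mulVec y j + γ ^ 3 * m j * (min (y j - ψ j) 0) ^ 3 = b j := by
  have hweight (j : Fin n) : 0 ≤ γ ^ 3 * m j := mul_nonneg (pow_nonneg hγ 3) (hm j)
  set f : Fin n → ℝ → ℝ := fun j t => γ ^ 3 * m j * min (t - ψ j) 0 ^ 3 with hf
  have hderiv (j : Fin n) (t : ℝ) :
      HasDerivAt (fun s => γ ^ 3 * m j / 4 * min (s - ψ j) 0 ^ 4) (f j t) t := by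
    refine (((hasDerivAt_min_zero_pow_four (t - ψ j)).comp_sub_const t (ψ j)).const_mul
      (γ ^ 3 * m j / 4)).congr_deriv ?_
    simp only [hf]
    ring
  have hmono (j : Fin n) : Monotone (f j) := fun s t hst =>
    mul_le_mul_of_nonneg_left ((Odd.strictMono_pow (by decide)).monotone
      (min_le_min_right 0 (sub_le_sub_right hst (ψ j)))) (hweight j)
  obtain ⟨y, hy⟩ := hA.exists_mulVec_add_eq hAsymm
    (F := fun j s => γ ^ 3 * m j / 4 * min (s - ψ j) 0 ^ 4)
    (fun j t => mul_nonneg (div_nonneg (hweight j) (by norm_num)) (Even.pow_nonneg (by decide) _))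
    hderiv b
  exact ⟨y, hy, fun z hz => hA.eq_of_mulVec_add_eq hmono fun j => (hz j).trans (hy j).symm⟩
end

section
/- For all real numbers s and t, (min(s,0))² · t ≥ (2/3)·(min(s,0))³ + (1/3)·(min(t,0))³. -/
theorem stmt_10 (s t : ℝ) :
    (2 / 3) * (min s 0) ^ 3 + (1 / 3) * (min t 0) ^ 3 ≤ (min s 0) ^ 2 * t := by
  have ha : min s 0 ≤ 0 := min_le_right s 0
  have hb : min t 0 ≤ 0 := min_le_right t 0
  have hbt : (min s 0) ^ 2 * min t 0 ≤ (min s 0) ^ 2 * t :=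
    mul_le_mul_of_nonneg_left (min_le_left t 0) (sq_nonneg _)
  have young : (min s 0 - min t 0) ^ 2 * (2 * min s 0 + min t 0) ≤ 0 :=
    mul_nonpos_of_nonneg_of_nonpos (sq_nonneg _) (by linarith)
  linarith
end

section
/- For all real numbers a and b, −(min(b,0))³ − 2·(min(a,0))³ + 3·(min(a,0))²·b ≥ 0. -/
theorem stmt_11 (a b : ℝ) :
    0 ≤ -(min b 0) ^ 3 - 2 * (min a 0) ^ 3 + 3 * (min a 0) ^ 2 * b := by
  have ha : min a 0 ≤ 0 := min_le_right a 0
  have hb : min b 0 ≤ 0 := min_le_right b 0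
  have hle : min b 0 ≤ b := min_le_left b 0
  generalize min a 0 = x at *
  generalize min b 0 = y at *
  have hfactor : 0 ≤ (x - y) ^ 2 * (-2 * x - y) :=
    mul_nonneg (sq_nonneg _) (by linarith)
  have hmul : 0 ≤ x ^ 2 * (b - y) := mul_nonneg (sq_nonneg x) (by linarith)
  linarith
end

section
/- Let η, p, a, b be real numbers with η ≤ 0, a < 0 and 3p ≥ −η·a. Define r := −(min(b,0))³ − 2·(min(a,0))³ + 3·(min(a,0))²·b. Then p·r ≥ η·(b − a)·((min(b,0))³ − (min(a,0))³). -/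
theorem stmt_13 (η p a b : ℝ) (hη : η ≤ 0) (ha : a < 0) (hp : -η * a ≤ 3 * p) :
    η * (b - a) * ((min b 0) ^ 3 - (min a 0) ^ 3) ≤
      p * (-(min b 0) ^ 3 - 2 * (min a 0) ^ 3 + 3 * (min a 0) ^ 2 * b) := by
  rw [min_eq_left ha.le]
  obtain ⟨r, hr⟩ : ∃ r, r = -(min b 0) ^ 3 - 2 * a ^ 3 + 3 * a ^ 2 * b := ⟨_, rfl⟩
  rw [← hr]
  -- It suffices that `r` is nonnegative and that the claim holds for the smallest admissible `p`.
  suffices h : 0 ≤ r ∧ -a * r ≤ 3 * ((b - a) * ((min b 0) ^ 3 - a ^ 3)) by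
    have hpr := mul_le_mul_of_nonneg_right hp h.1
    have hηr := mul_le_mul_of_nonpos_left h.2 hη
    linarith
  rcases le_total b 0 with hb | hb
  · rw [min_eq_left hb] at hr ⊢
    have hr' : r = (a - b) ^ 2 * (-b - 2 * a) := by rw [hr]; ring
    refine ⟨hr' ▸ mul_nonneg (sq_nonneg _) (by linarith), ?_⟩
    have hab : 0 ≤ a * b := mul_nonneg_of_nonpos_of_nonpos ha.le hb
    have hq : 0 ≤ (a - b) ^ 2 * (a ^ 2 + 2 * (a * b) + 3 * b ^ 2) := by positivity
    rw [hr']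
    linarith
  · rw [min_eq_right hb] at hr ⊢
    have ha3 : a ^ 3 ≤ 0 := Odd.pow_nonpos (by decide) ha.le
    have hab : 0 ≤ a ^ 2 * b := by positivity
    have ha4 : 0 ≤ a ^ 4 := by positivity
    rw [hr]
    constructor <;> linarith
end

section
/- Let n ≥ 1, let A be a real symmetric n×n matrix, let m ∈ ℝⁿ with m_j ≥ 0 for all j, let γ ≥ 0, and let ψ, b, b̃ ∈ ℝⁿ. Suppose y, ỹ ∈ ℝⁿ satisfy, for every j, (Ay)_j + γ³ m_j ((y_j − ψ_j)⁻)³ = b_j and (Aỹ)_j + γ³ m_j ((ỹ_j − ψ_j)⁻)³ = b̃_j. Then (b̃ − b)ᵀ(ỹ − y) ≥ (ỹ − y)ᵀ A (ỹ − y). -/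
open Matrix

/-- The cube of the negative part is a monotone function. -/
theorem monotone_min_zero_pow_three : Monotone fun s : ℝ => (min s 0) ^ 3 := fun _ _ h =>
  (Odd.strictMono_pow (by decide : Odd 3)).monotone (min_le_min_right 0 h)

/-- A monotone function satisfies `0 ≤ (t - s) * (f t - f s)`. -/
theorem Monotone.sub_mul_sub_nonneg {f : ℝ → ℝ} (hf : Monotone f) (s t : ℝ) :
    0 ≤ (t - s) * (f t - f s) := by
  rcases le_total s t with h | h
  · exact mul_nonneg (sub_nonneg.2 h) (sub_nonneg.2 (hf h))
  · exact mul_nonneg_of_nonpos_of_nonpos (sub_nonpos.2 h) (sub_nonpos.2 (hf h))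

theorem stmt_18 (n : ℕ) (hn : 1 ≤ n)
    (A : Matrix (Fin n) (Fin n) ℝ) (hA : A.IsSymm)
    (m : Fin n → ℝ) (hm : ∀ j, 0 ≤ m j)
    (γ : ℝ) (hγ : 0 ≤ γ)
    (ψ b btil : Fin n → ℝ) (y ytil : Fin n → ℝ)
    (hy : ∀ j, A.mulVec y j + γ ^ 3 * m j * (min (y j - ψ j) 0) ^ 3 = b j)
    (hytil : ∀ j, A.mulVec ytil j + γ ^ 3 * m j * (min (ytil j - ψ j) 0) ^ 3 = btil j) :
    (ytil - y) ⬝ᵥ A.mulVec (ytil - y) ≤ (btil - b) ⬝ᵥ (ytil - y) := by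
  rw [dotProduct_comm, mulVec_sub]
  refine Finset.sum_le_sum fun j _ => ?_
  have hmono := mul_nonneg (mul_nonneg (pow_nonneg hγ 3) (hm j))
    (monotone_min_zero_pow_three.sub_mul_sub_nonneg (y j - ψ j) (ytil j - ψ j))
  simp only [Pi.sub_apply, ← hy j, ← hytil j]
  linear_combination hmono
end
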